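/- arXiv:1302.6627 — 4 statements merged into one kernel-verified Lean document; each statement's English description precedes it below -/
import Mathlib

section
/- Let N be a nilpotent skew-symmetric n×n complex matrix (Nᵀ = −N, i.e., N lies in so(n,ℂ) for the standard symmetric form). Then for every even integer r ≥ 2, the integer rank(N^{r−1}) − 2·rank(N^r) + rank(N^{r+1}) is even. Equivalently, every even part of the Jordan type of N occurs with even multiplicity. -/
/-- A skew-symmetric matrix with nonzero determinant has even size. -/
theorem Matrix.even_card_of_transpose_eq_neg_of_det_ne_zero {ι K : Type*} [Fintype ι]
    [DecidableEq ι] [Field K] [NeZero (2 : K)] {A : Matrix ι ι K} (hA : A.transpose = -A)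
    (hdet : A.det ≠ 0) : Even (Fintype.card ι) := by
  by_contra hodd
  rw [Nat.not_even_iff_odd] at hodd
  have h : A.det = -A.det := by
    conv_lhs => rw [← Matrix.det_transpose, hA, Matrix.det_neg, hodd.neg_one_pow, neg_one_mul]
  have h2 : (2 : K) * A.det = 0 := by linear_combination h
  exact hdet ((mul_eq_zero.mp h2).resolve_left two_ne_zero)

/-- A skew-symmetric matrix over a field of characteristic different from two has even rank. -/
theorem Matrix.even_rank_of_transpose_eq_neg {ι K : Type*} [Fintype ι] [DecidableEq ι] [Field K]
    [NeZero (2 : K)] {A : Matrix ι ι K} (hA : A.transpose = -A) : Even A.rank := by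
  obtain ⟨W, hW⟩ := Submodule.exists_isCompl (LinearMap.ker A.mulVecLin)
  have hskew (x y : ι → K) : x ⬝ᵥ A.mulVec y = -(y ⬝ᵥ A.mulVec x) := by
    rw [Matrix.dotProduct_mulVec, ← Matrix.mulVec_transpose, hA, Matrix.neg_mulVec,
      neg_dotProduct, dotProduct_comm]
  have hrank : Module.finrank K W = A.rank := by
    have h₁ := Submodule.finrank_add_eq_of_isCompl hW
    have h₂ := A.mulVecLin.finrank_range_add_finrank_ker
    rw [Matrix.rank]
    omega
  let B : LinearMap.BilinForm K W := (Matrix.toBilin' A).restrict W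
  have hB (x y : W) : B x y = (x : ι → K) ⬝ᵥ A.mulVec y := Matrix.toBilin'_apply' A x y
  have hnondeg : B.Nondegenerate := by
    refine LinearMap.BilinForm.Nondegenerate.ofSeparatingRight fun y hy => ?_
    have hker : A.mulVec y = 0 := by
      refine dotProduct_eq_zero _ fun v => ?_
      obtain ⟨k, hk, w, hw, rfl⟩ := Submodule.mem_sup.mp
        (hW.sup_eq_top ▸ Submodule.mem_top : v ∈ LinearMap.ker A.mulVecLin ⊔ W)
      have hk0 : A.mulVec k = 0 := hk
      have hwy : w ⬝ᵥ A.mulVec y = 0 := (hB ⟨w, hw⟩ y).symm.trans (hy ⟨w, hw⟩)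
      rw [dotProduct_comm, add_dotProduct, hwy, hskew, hk0, dotProduct_zero, neg_zero, add_zero]
    exact Subtype.ext (Submodule.disjoint_def.mp hW.disjoint _ hker y.2)
  let b := Module.finBasis K W
  have htr : (LinearMap.BilinForm.toMatrix b B).transpose = -LinearMap.BilinForm.toMatrix b B := by
    ext i j
    simp only [Matrix.transpose_apply, Matrix.neg_apply, LinearMap.BilinForm.toMatrix_apply, hB]
    exact hskew _ _
  have h := Matrix.even_card_of_transpose_eq_neg_of_det_ne_zero htr
    ((LinearMap.BilinForm.nondegenerate_iff_det_ne_zero b).mp hnondeg)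
  rwa [Fintype.card_fin, hrank] at h

/-- For a nilpotent skew-symmetric `N ∈ so(n, ℂ)` (i.e. `Nᵀ = -N`),
and every even `r ≥ 2`, the integer `rank(N^(r-1)) − 2 rank(N^r) + rank(N^(r+1))` is even. -/
theorem so_nilpotent_even_parts_even_multiplicity
    (n : ℕ) (N : Matrix (Fin n) (Fin n) ℂ)
    (hnil : IsNilpotent N)
    (hso : N.transpose = -N) :
    ∀ r : ℕ, Even r → 2 ≤ r →
      Even (((N ^ (r - 1)).rank : ℤ) - 2 * ((N ^ r).rank : ℤ) + ((N ^ (r + 1)).rank : ℤ)) := by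
  intro r hr h2
  have hodd {k : ℕ} (hk : Odd k) : Even ((N ^ k).rank : ℤ) := by
    refine (Int.even_coe_nat _).mpr (Matrix.even_rank_of_transpose_eq_neg ?_)
    rw [Matrix.transpose_pow, hso, hk.neg_pow]
  exact ((hodd (Nat.Even.sub_odd (by omega) hr odd_one)).sub (even_two_mul _)).add (hodd hr.add_one)
end

section
/- Let λ = (λ₁ ≥ λ₂ ≥ …) be a partition of n in which every even part occurs with even multiplicity. Then there exists a nilpotent skew-symmetric n×n complex matrix N (Nᵀ = −N) such that rank(N^r) = Σ_i max(λ_i − r, 0) for every r ≥ 0; that is, λ is the Jordan type of a nilpotent element of so(n,ℂ). -/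
open Matrix

/-- Over a field, every square matrix is equivalent to a diagonal matrix. -/
theorem Matrix.exists_isUnit_mul_mul_eq_diagonal {m K : Type*} [Fintype m] [DecidableEq m]
    [Field K] (M : Matrix m m K) :
    ∃ (V U : Matrix m m K) (d : m → K), IsUnit V.det ∧ IsUnit U.det ∧ V * M * U = diagonal d := by
  obtain ⟨V, U, e, hV, hU, h⟩ := M.exists_rank_normal_form
  refine ⟨V, U, (Sum.elim (fun _ => 1) (fun _ => 0)) ∘ e, (isUnit_iff_isUnit_det _).1 hV,
    (isUnit_iff_isUnit_det _).1 hU, ?_⟩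
  rw [h, ← submatrix_diagonal_equiv, ← fromBlocks_diagonal, diagonal_one, diagonal_zero]

/-- The rank of a block diagonal matrix is the sum of the ranks of the blocks. -/
theorem Matrix.rank_fromBlocks_diagonal {m n K : Type*} [Fintype m] [DecidableEq m]
    [Fintype n] [DecidableEq n] [Field K] (A : Matrix m m K) (D : Matrix n n K) :
    (fromBlocks A 0 0 D).rank = A.rank + D.rank := by
  classical
  obtain ⟨V, U, a, hV, hU, hA⟩ := A.exists_isUnit_mul_mul_eq_diagonal
  obtain ⟨V', U', d, hV', hU', hD⟩ := D.exists_isUnit_mul_mul_eq_diagonal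
  have h : fromBlocks V 0 0 V' * fromBlocks A 0 0 D * fromBlocks U 0 0 U' =
      diagonal (Sum.elim a d) := by
    simp [fromBlocks_multiply, hA, hD, ← fromBlocks_diagonal]
  have hVV : IsUnit (fromBlocks V 0 0 V').det := by
    rw [det_fromBlocks_zero₂₁]; exact hV.mul hV'
  have hUU : IsUnit (fromBlocks U 0 0 U').det := by
    rw [det_fromBlocks_zero₂₁]; exact hU.mul hU'
  rw [← rank_mul_eq_right_of_isUnit_det _ _ hVV, ← rank_mul_eq_left_of_isUnit_det _ _ hUU, h,
    ← rank_mul_eq_right_of_isUnit_det _ A hV, ← rank_mul_eq_left_of_isUnit_det _ _ hU, hA,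
    ← rank_mul_eq_right_of_isUnit_det _ D hV', ← rank_mul_eq_left_of_isUnit_det _ _ hU', hD,
    rank_diagonal, rank_diagonal, rank_diagonal, ← Fintype.card_sum]
  exact Fintype.card_congr (Equiv.subtypeSum (p := fun i => Sum.elim a d i ≠ 0))

/-- The nilpotent Jordan block of size `k`, with ones below the diagonal. -/
def nilpotentJordanBlock (k : ℕ) : Matrix (Fin k) (Fin k) ℂ :=
  of fun i j => if (i : ℕ) = j + 1 then 1 else 0

theorem nilpotentJordanBlock_apply (k : ℕ) (i j : Fin k) :
    nilpotentJordanBlock k i j = if (i : ℕ) = j + 1 then 1 else 0 :=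
  rfl

theorem nilpotentJordanBlock_pow_apply (k r : ℕ) (i j : Fin k) :
    (nilpotentJordanBlock k ^ r) i j = if (i : ℕ) = j + r then 1 else 0 := by
  induction r generalizing i j with
  | zero => simp [one_apply, Fin.ext_iff]
  | succ r ih =>
    rw [pow_succ, mul_apply]
    simp only [ih, nilpotentJordanBlock_apply, mul_ite, mul_one, mul_zero]
    by_cases hj : (j : ℕ) + 1 < k
    · rw [Finset.sum_eq_single ⟨j + 1, hj⟩]
      · simp only [if_true]
        congr 1
        simp only [eq_iff_iff]
        omega
      · intro l _ hl
        rw [if_neg fun h => hl (Fin.ext h)]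
      · simp
    · rw [if_neg (by omega)]
      exact Finset.sum_eq_zero fun l _ => if_neg (by omega)

open scoped ComplexOrder in
theorem rank_nilpotentJordanBlock_pow (k r : ℕ) : (nilpotentJordanBlock k ^ r).rank = k - r := by
  classical
  have h : nilpotentJordanBlock k ^ r * (nilpotentJordanBlock k ^ r)ᴴ =
      diagonal fun i : Fin k => if r ≤ (i : ℕ) then (1 : ℂ) else 0 := by
    ext i j
    simp only [mul_apply, conjTranspose_apply, nilpotentJordanBlock_pow_apply, diagonal_apply]
    by_cases hi : r ≤ (i : ℕ)
    · rw [Finset.sum_eq_single ⟨i - r, by omega⟩]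
      · simp only [Fin.ext_iff]
        split_ifs <;> first | omega | simp
      · intro l _ hl
        rw [if_neg fun h => hl (Fin.ext (by simp; omega)), zero_mul]
      · simp
    · rw [Finset.sum_eq_zero]
      · simp [hi]
      · intro l _
        rw [if_neg (by omega), zero_mul]
  rw [← rank_self_mul_conjTranspose, h, rank_diagonal]
  have e : {i : Fin k // (if r ≤ (i : ℕ) then (1 : ℂ) else 0) ≠ 0} ≃ Fin (k - r) :=
    { toFun := fun i => ⟨i.1 - r, by
        have : r ≤ (i.1 : ℕ) := by
          by_contra h
          exact i.2 (if_neg h)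
        omega⟩
      invFun := fun i => ⟨⟨i + r, by omega⟩, by simp⟩
      left_inv := fun i => by
        have : r ≤ (i.1 : ℕ) := by
          by_contra h
          exact i.2 (if_neg h)
        ext
        simp
        omega
      right_inv := fun i => by simp }
  rw [Fintype.card_congr e, Fintype.card_fin]

/-- A multiset `s` of natural numbers has an orthogonal model if some matrix whose powers have the
ranks prescribed by the Jordan type `s` is skew-adjoint for the bilinear form given by a symmetric
involutive matrix. -/
def HasOrthogonalModel (s : Multiset ℕ) : Prop :=
  ∃ (ι : Type) (_ : Fintype ι) (_ : DecidableEq ι) (X S : Matrix ι ι ℂ),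
    Fintype.card ι = s.sum ∧ Sᵀ = S ∧ S * S = 1 ∧ Xᵀ * S = -(S * X) ∧
      ∀ r : ℕ, (X ^ r).rank = (s.map (fun p => p - r)).sum

namespace HasOrthogonalModel

theorem zero : HasOrthogonalModel 0 :=
  ⟨Fin 0, inferInstance, inferInstance, 0, 1, by simp, by simp, by simp, by simp, fun r => by
    rw [Subsingleton.elim ((0 : Matrix (Fin 0) (Fin 0) ℂ) ^ r) 0]; simp⟩

theorem add {s t : Multiset ℕ} (hs : HasOrthogonalModel s) (ht : HasOrthogonalModel t) :
    HasOrthogonalModel (s + t) := by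
  obtain ⟨ι, _, _, X, S, hc, hS, hSS, hX, hr⟩ := hs
  obtain ⟨κ, _, _, Y, T, hc', hT, hTT, hY, hr'⟩ := ht
  refine ⟨ι ⊕ κ, inferInstance, inferInstance, fromBlocks X 0 0 Y, fromBlocks S 0 0 T,
    by simp [hc, hc'], by simp [fromBlocks_transpose, hS, hT],
    by simp [fromBlocks_multiply, hSS, hTT],
    by simp [fromBlocks_transpose, fromBlocks_multiply, fromBlocks_neg, hX, hY], fun r => ?_⟩
  rw [fromBlocks_diagonal_pow, rank_fromBlocks_diagonal, hr, hr', Multiset.map_add,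
    Multiset.sum_add]

theorem pair (k : ℕ) : HasOrthogonalModel {k, k} := by
  refine ⟨Fin k ⊕ Fin k, inferInstance, inferInstance,
    fromBlocks (nilpotentJordanBlock k) 0 0 (-(nilpotentJordanBlock k)ᵀ), fromBlocks 0 1 1 0,
    by simp, by simp [fromBlocks_transpose], by simp [fromBlocks_multiply],
    by simp [fromBlocks_transpose, fromBlocks_multiply, fromBlocks_neg], fun r => ?_⟩
  have h : (-(nilpotentJordanBlock k)ᵀ) ^ r =
      (-1 : Matrix (Fin k) (Fin k) ℂ) ^ r * (nilpotentJordanBlock k ^ r)ᵀ := by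
    rw [neg_pow, transpose_pow]
  have hu : IsUnit ((-1 : Matrix (Fin k) (Fin k) ℂ) ^ r).det :=
    (isUnit_iff_isUnit_det _).1 (isUnit_one.neg.pow r)
  rw [fromBlocks_diagonal_pow, rank_fromBlocks_diagonal, h, rank_mul_eq_right_of_isUnit_det _ _ hu,
    rank_transpose, rank_nilpotentJordanBlock_pow]
  simp

theorem singleton_of_odd {k : ℕ} (hk : Odd k) : HasOrthogonalModel {k} := by
  have hsymm : ∀ a b : ℕ, a + b + 1 = k → (-1 : ℂ) ^ a = (-1) ^ b := fun a b h => by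
    rw [neg_one_pow_congr]
    grind
  refine ⟨Fin k, inferInstance, inferInstance, nilpotentJordanBlock k,
    of fun i j => if (i : ℕ) + j + 1 = k then (-1) ^ (i : ℕ) else 0, by simp, ?_, ?_, ?_,
    fun r => by simp [rank_nilpotentJordanBlock_pow]⟩
  · ext i j
    simp only [transpose_apply, of_apply, add_comm (j : ℕ) i]
    split_ifs with h
    · exact (hsymm _ _ h).symm
    · rfl
  · ext i j
    rw [mul_apply, Finset.sum_eq_single i.rev]
    · simp only [of_apply, Fin.val_rev, one_apply, Fin.ext_iff]
      rw [if_pos (by omega)]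
      by_cases h : (i : ℕ) = j
      · rw [if_pos (by omega), if_pos h, hsymm i (k - (i + 1)) (by omega), ← mul_pow]
        simp
      · rw [if_neg (by omega), if_neg h, mul_zero]
    · intro l _ hl
      rw [of_apply, if_neg, zero_mul]
      intro h
      exact hl (Fin.ext (by rw [Fin.val_rev]; omega))
    · simp
  · ext i j
    simp only [Matrix.neg_apply, mul_apply, transpose_apply, nilpotentJordanBlock_apply, of_apply]
    by_cases h : (i : ℕ) + j + 2 = k
    · rw [Finset.sum_eq_single (⟨i + 1, by omega⟩ : Fin k),
        Finset.sum_eq_single (⟨j + 1, by omega⟩ : Fin k)]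
      · simp only [if_true]
        rw [if_pos (by omega), if_pos (by omega)]
        ring
      · intro l _ hl
        rw [if_neg (fun h => hl (Fin.ext h)), mul_zero]
      · simp
      · intro l _ hl
        rw [if_neg (fun h => hl (Fin.ext h)), zero_mul]
      · simp
    · rw [Finset.sum_eq_zero, Finset.sum_eq_zero, neg_zero]
      · intro l _
        split_ifs <;> first | omega | simp
      · intro l _
        split_ifs <;> first | omega | simp

theorem of_even_count (s : Multiset ℕ) (h : ∀ p : ℕ, Even p → Even (s.count p)) :
    HasOrthogonalModel s := by
  induction s using Multiset.strongInductionOn with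
  | ih s ih =>
  rcases s.empty_or_exists_mem with rfl | ⟨p, hp⟩
  · exact zero
  obtain ⟨t, rfl⟩ := Multiset.exists_cons_of_mem hp
  rcases Nat.even_or_odd p with hpe | hpo
  · have hpt : p ∈ t := by
      rw [← Multiset.one_le_count_iff_mem]
      have := h p hpe
      rw [Multiset.count_cons_self] at this
      grind
    obtain ⟨u, rfl⟩ := Multiset.exists_cons_of_mem hpt
    suffices hu : HasOrthogonalModel u by
      simpa [Multiset.insert_eq_cons] using (pair p).add hu
    refine ih u ((Multiset.lt_cons_self _ _).trans (Multiset.lt_cons_self _ _)) ?_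
    intro q hq
    have := h q hq
    simp only [Multiset.count_cons] at this
    grind
  · refine (singleton_of_odd hpo).add (ih t (Multiset.lt_cons_self _ _) ?_)
    intro q hq
    have := h q hq
    rwa [Multiset.count_cons_of_ne (by rintro rfl; exact (Nat.not_even_iff_odd.2 hpo) hq)] at this

/-- An orthogonal model can be transported to the standard symmetric form. With `S` the symmetric
involution, `1 + i S` is, up to a scalar, a symmetric square root of `S`. -/
theorem exists_transpose_eq_neg {s : Multiset ℕ} (hs : HasOrthogonalModel s) :
    ∃ N : Matrix (Fin s.sum) (Fin s.sum) ℂ, Nᵀ = -N ∧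
      ∀ r : ℕ, (N ^ r).rank = (s.map (fun p => p - r)).sum := by
  obtain ⟨ι, _, _, X, S, hc, hS, hSS, hX, hr⟩ := hs
  let e : ι ≃ Fin s.sum := Fintype.equivFinOfCardEq hc
  let P : Matrix ι ι ℂ := 1 + Complex.I • S
  let Q : Matrix ι ι ℂ := (2⁻¹ : ℂ) • (1 - Complex.I • S)
  have hPQ : P * Q = 1 := by
    simp only [P, Q, mul_smul_comm, add_mul, mul_sub, smul_mul_assoc, hSS, one_mul,
      mul_one]
    match_scalars <;> first | ring1 | linear_combination (-1 / 2 : ℂ) * Complex.I_mul_I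
  have hQP : Q * P = 1 := mul_eq_one_comm.1 hPQ
  have hXt : Xᵀ = -(S * X * S) := by
    rw [← neg_mul, ← hX, mul_assoc, hSS, mul_one]
  have hQS : Qᵀ * S = (-Complex.I * 2⁻¹) • P := by
    simp only [P, Q, transpose_smul, transpose_sub, transpose_one, hS, smul_mul_assoc, sub_mul, hSS,
      one_mul, smul_add, smul_smul]
    rw [show -Complex.I * 2⁻¹ * Complex.I = 2⁻¹ by linear_combination -2⁻¹ * Complex.I_mul_I]
    module
  have hSP : S * Pᵀ = (Complex.I * 2) • Q := by
    simp only [P, Q, transpose_smul, transpose_add, transpose_one, hS, mul_smul_comm, mul_add, hSS,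
      mul_one, smul_sub, smul_smul]
    rw [show Complex.I * 2 * (2⁻¹ * Complex.I) = -1 by linear_combination Complex.I_mul_I]
    module
  have hN : (P * X * Q)ᵀ = -(P * X * Q) := by
    calc (P * X * Q)ᵀ = -((Qᵀ * S) * X * (S * Pᵀ)) := by
          rw [transpose_mul, transpose_mul, hXt]
          noncomm_ring
      _ = -(P * X * Q) := by
          rw [hQS, hSP]
          simp only [smul_mul_assoc, mul_smul_comm, smul_smul]
          rw [show Complex.I * 2 * (-Complex.I * 2⁻¹) = 1 by
            linear_combination -Complex.I_mul_I, one_smul]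
  have hpow : ∀ r : ℕ, (P * X * Q) ^ r = P * X ^ r * Q :=
    fun r => Units.conj_pow ⟨P, Q, hPQ, hQP⟩ X r
  refine ⟨reindexAlgEquiv ℂ ℂ e (P * X * Q), ?_, fun r => ?_⟩
  · rw [coe_reindexAlgEquiv, transpose_reindex, hN]
    rfl
  · rw [← map_pow, coe_reindexAlgEquiv, rank_reindex, hpow,
      rank_mul_eq_left_of_isUnit_det _ _ (isUnit_det_of_left_inverse hPQ),
      rank_mul_eq_right_of_isUnit_det _ _ (isUnit_det_of_left_inverse hQP), hr]

end HasOrthogonalModel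

/-- Every partition of `n` in which each even part occurs with even multiplicity
is the Jordan type of a nilpotent element of `so(n, ℂ)`: there is a nilpotent skew-symmetric
matrix `N` with `rank(N^r) = Σᵢ max(λᵢ − r, 0)` for all `r`. -/
theorem partition_is_so_jordan_type
    (n : ℕ) (P : Nat.Partition n)
    (heven : ∀ p : ℕ, Even p → Even (P.parts.count p)) :
    ∃ N : Matrix (Fin n) (Fin n) ℂ,
      IsNilpotent N ∧
      N.transpose = -N ∧
      ∀ r : ℕ, (N ^ r).rank = (P.parts.map (fun p => p - r)).sum := by
  obtain ⟨parts, _, rfl⟩ := P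
  obtain ⟨N, hN, hr⟩ := (HasOrthogonalModel.of_even_count parts heven).exists_transpose_eq_neg
  refine ⟨N, ⟨parts.sum, ?_⟩, hN, hr⟩
  have h0 : (N ^ parts.sum).rank = 0 := by
    rw [hr, Multiset.sum_eq_zero_iff]
    intro x hx
    obtain ⟨p, hp, rfl⟩ := Multiset.mem_map.1 hx
    exact Nat.sub_eq_zero_of_le (Multiset.le_sum_of_mem hp)
  rw [Matrix.rank, Submodule.finrank_eq_zero, LinearMap.range_eq_bot] at h0
  exact toLin'.injective (by rw [map_zero]; exact h0)
end

section
/- Let N and M be nilpotent skew-symmetric n×n complex matrices (Nᵀ = −N, Mᵀ = −M). Then there exists g ∈ O(n,ℂ) (i.e., gᵀ·g = I) with M = g·N·g⁻¹ if and only if rank(N^r) = rank(M^r) for every r ≥ 1. In other words, nilpotent O(n,ℂ)-orbits in so(n,ℂ) are classified by their Jordan types. -/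
open Polynomial
open scoped Matrix

theorem Polynomial.exists_prime_pow_dvd_sq_sub_X {p : ℂ[X]} (hp : Prime p) (h0 : ¬ p ∣ X)
    (k : ℕ) : ∃ q : ℂ[X], p ^ (k + 1) ∣ q ^ 2 - X := by
  induction k with
  | zero =>
    obtain ⟨a, ha⟩ := Complex.exists_root (f := p)
      (natDegree_pos_iff_degree_pos.1 hp.irreducible.natDegree_pos)
    obtain ⟨b, hb⟩ := IsAlgClosed.exists_pow_nat_eq a (n := 2) (by norm_num)
    have h1 : Associated (X - C a) p :=
      (irreducible_X_sub_C a).associated_of_dvd hp.irreducible (dvd_iff_isRoot.2 ha)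
    refine ⟨C b, ?_⟩
    rw [zero_add, pow_one]
    refine h1.symm.dvd.trans ⟨-1, ?_⟩
    rw [← hb, C_pow]; ring
  | succ k ih =>
    obtain ⟨q, hq⟩ := ih
    have hpq : ¬ p ∣ C 2 * q := by
      intro h
      have hu : IsUnit (C (2 : ℂ)) := isUnit_C.2 (by simp)
      have h2 : p ∣ q := (hu.dvd_mul_left).1 h
      apply h0
      have h3 : p ∣ q ^ 2 - X := (dvd_pow_self p k.succ_ne_zero).trans hq
      exact (dvd_sub_right (dvd_pow h2 two_ne_zero)).1 h3
    obtain ⟨a, b, hab⟩ := (hp.irreducible.coprime_iff_not_dvd).2 hpq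
    obtain ⟨c, hc⟩ := hq
    refine ⟨q - b * (q ^ 2 - X), a * c + b ^ 2 * p ^ k * c ^ 2, ?_⟩
    have hC : (C (2 : ℂ)) = 2 := rfl
    rw [hC] at hab
    have : (q - b * (q ^ 2 - X)) ^ 2 - X
      = (q ^ 2 - X) * (1 - b * (2 * q)) + b ^ 2 * (q ^ 2 - X) ^ 2 := by ring
    rw [this, ← hab, hc]
    ring

/-- `X` is a square modulo every complex polynomial that does not vanish at `0`. -/
theorem Polynomial.exists_dvd_sq_sub_X {f : ℂ[X]} (hf : f ≠ 0) (h0 : f.eval 0 ≠ 0) :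
    ∃ q : ℂ[X], f ∣ q ^ 2 - X := by
  induction f using UniqueFactorizationMonoid.induction_on_coprime with
  | h0 => exact absurd rfl hf
  | h1 hx => exact ⟨0, hx.dvd⟩
  | hpr i hp =>
    rename_i p
    cases i with
    | zero => exact ⟨0, by simp⟩
    | succ k =>
      refine exists_prime_pow_dvd_sq_sub_X hp (fun h => h0 ?_) k
      have h1 : p ∣ X := h
      obtain ⟨a, ha⟩ := Complex.exists_root (f := p)
        (natDegree_pos_iff_degree_pos.1 hp.irreducible.natDegree_pos)
      have : (X : ℂ[X]).eval a = 0 := eval_eq_zero_of_dvd_of_eval_eq_zero h1 ha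
      rw [eval_X] at this
      subst this
      rw [eval_pow, ha.eq_zero, zero_pow k.succ_ne_zero]
  | hcp hxy hx hy =>
    rename_i x y
    rw [eval_mul] at h0
    obtain ⟨q, hq⟩ := hx (left_ne_zero_of_mul hf) (left_ne_zero_of_mul h0)
    obtain ⟨r, hr⟩ := hy (right_ne_zero_of_mul hf) (right_ne_zero_of_mul h0)
    have hc : IsCoprime x y := hxy.isCoprime
    obtain ⟨u, v, huv⟩ := id hc
    obtain ⟨s, hs⟩ := hq
    obtain ⟨t, ht⟩ := hr
    refine ⟨q + u * x * (r - q), hc.mul_dvd ?_ ?_⟩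
    · exact ⟨s + 2 * q * u * (r - q) + u ^ 2 * x * (r - q) ^ 2, by linear_combination hs⟩
    · refine ⟨t - 2 * r * v * (r - q) + v ^ 2 * y * (r - q) ^ 2, ?_⟩
      have : q + u * x * (r - q) = r - v * y * (r - q) := by linear_combination (r - q) * huv
      rw [this]; linear_combination ht

/-- An invertible complex matrix has a square root that is a polynomial in it. -/
theorem Matrix.exists_aeval_sq_eq {ι : Type*} [Fintype ι] [DecidableEq ι]
    (S : Matrix ι ι ℂ) (hS : IsUnit S.det) :
    ∃ q : ℂ[X], aeval S q ^ 2 = S := by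
  obtain ⟨q, r, hr⟩ := Polynomial.exists_dvd_sq_sub_X S.charpoly_monic.ne_zero (by
    rw [← coeff_zero_eq_eval_zero]
    intro h
    rw [Matrix.det_eq_sign_charpoly_coeff, h, mul_zero] at hS
    exact not_isUnit_zero hS)
  refine ⟨q, ?_⟩
  have := congrArg (aeval S) hr
  rw [map_mul, Matrix.aeval_self_charpoly, zero_mul, map_sub, map_pow, aeval_X] at this
  exact sub_eq_zero.1 this

theorem Matrix.transpose_aeval {ι : Type*} [Fintype ι] [DecidableEq ι]
    (S : Matrix ι ι ℂ) (q : ℂ[X]) : (aeval S q)ᵀ = aeval Sᵀ q := by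
  induction q using Polynomial.induction_on' with
  | add p q hp hq => simp [hp, hq]
  | monomial k a => simp [aeval_monomial, Algebra.algebraMap_eq_smul_one]

theorem Polynomial.commute_aeval_left {R A : Type*} [CommSemiring R] [Semiring A] [Algebra R A]
    {a b : A} (h : Commute a b) (q : R[X]) : Commute (aeval a q) b := by
  induction q using Polynomial.induction_on' with
  | add p q hp hq => rw [map_add]; exact hp.add_left hq
  | monomial k c =>
    rw [aeval_monomial]; exact (Algebra.commute_algebraMap_left c b).mul_left (h.pow_left k)

/-- Similar skew-symmetric complex matrices are orthogonally similar. -/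
theorem Matrix.exists_orthogonal_conj_of_similar {ι : Type*} [Fintype ι] [DecidableEq ι]
    {N M P : Matrix ι ι ℂ} (hN : Nᵀ = -N) (hM : Mᵀ = -M) (hP : IsUnit P.det)
    (h : P * N = M * P) :
    ∃ g : Matrix ι ι ℂ, gᵀ * g = 1 ∧ M = g * N * g⁻¹ := by
  have hcomm : Commute (Pᵀ * P) N := by
    have h' := congrArg transpose h
    rw [transpose_mul, transpose_mul, hN, hM, neg_mul, mul_neg, neg_inj] at h'
    rw [commute_iff_eq, mul_assoc, h, ← mul_assoc, ← h', mul_assoc]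
  obtain ⟨q, hq⟩ := Matrix.exists_aeval_sq_eq (Pᵀ * P) (by
    rw [det_mul, det_transpose]; exact hP.mul hP)
  have hQt : (aeval (Pᵀ * P) q)ᵀ = aeval (Pᵀ * P) q := by
    rw [transpose_aeval, transpose_mul, transpose_transpose]
  have hQN : Commute (aeval (Pᵀ * P) q) N := by
    exact Polynomial.commute_aeval_left hcomm q
  generalize aeval (Pᵀ * P) q = Q at hq hQt hQN
  have hQ : IsUnit Q.det := by
    have := congrArg det hq
    rw [det_pow, det_mul, det_transpose] at this
    exact (isUnit_pow_iff two_ne_zero).1 (this ▸ hP.mul hP)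
  refine ⟨P * Q⁻¹, ?_, ?_⟩
  · rw [transpose_mul, transpose_nonsing_inv, hQt, mul_assoc, ← mul_assoc Pᵀ, ← hq, sq,
      mul_assoc Q, mul_nonsing_inv _ hQ, mul_one, nonsing_inv_mul _ hQ]
  · rw [mul_inv_rev, nonsing_inv_nonsing_inv _ hQ]
    have : Q⁻¹ * N * Q = N := by
      rw [mul_assoc, ← hQN.eq, ← mul_assoc, nonsing_inv_mul _ hQ, one_mul]
    rw [show P * Q⁻¹ * N * (Q * P⁻¹) = P * (Q⁻¹ * N * Q) * P⁻¹ by simp only [mul_assoc], this, h,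
      mul_assoc, mul_nonsing_inv _ hP, mul_one]

open Module

section Nilpotent

variable {K : Type*} [Field K]

/-- A complement, inside `ker f`, of the intersection of `ker f` with `range f`. -/
theorem LinearMap.exists_isCompl_range_in_ker {V : Type*} [AddCommGroup V] [Module K V]
    (f : V →ₗ[K] V) :
    ∃ C : Submodule K V, C ≤ ker f ∧ Disjoint C (range f) ∧
      ∀ v ∈ ker f, ∃ r ∈ range f, ∃ c ∈ C, v = r + c := by
  obtain ⟨D, hD⟩ := Submodule.exists_isCompl (ker f ⊓ range f)
  refine ⟨ker f ⊓ D, inf_le_left, ?_, fun v hv => ?_⟩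
  · rw [Submodule.disjoint_def]
    intro x hx hr
    exact Submodule.disjoint_def.1 hD.disjoint x ⟨hx.1, hr⟩ hx.2
  · obtain ⟨r, hr, d, hd, rfl⟩ :=
      Submodule.mem_sup.1 (hD.sup_eq_top ▸ Submodule.mem_top : v ∈ (ker f ⊓ range f) ⊔ D)
    exact ⟨r, hr.2, d, ⟨((ker f).add_mem_iff_right hr.1).1 hv, hd⟩, rfl⟩

theorem LinearMap.finrank_range_restrict_pow {V : Type*} [AddCommGroup V] [Module K V]
    (f : V →ₗ[K] V) (h : ∀ x ∈ range f, f x ∈ range f) (r : ℕ) :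
    finrank K (range ((f.restrict h) ^ r)) = finrank K (range (f ^ (r + 1))) := by
  have key : (range ((f.restrict h) ^ r)).map (range f).subtype = range (f ^ (r + 1)) := by
    ext x
    rw [Module.End.pow_restrict]
    constructor
    · rintro ⟨_, ⟨⟨_, y, rfl⟩, rfl⟩, rfl⟩
      exact ⟨y, by simp [pow_succ]⟩
    · rintro ⟨y, rfl⟩
      exact ⟨_, ⟨⟨f y, y, rfl⟩, rfl⟩, by simp [pow_succ]⟩
  rw [← Submodule.finrank_map_subtype_eq (range f) (range ((f.restrict h) ^ r)), key]

/-- The dimension of a complement of `ker f ⊓ range f` in `ker f` is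
determined by the ranks of `f` and `f ^ 2`. -/
theorem LinearMap.finrank_add_eq_of_isCompl_in_ker {V : Type*} [AddCommGroup V] [Module K V]
    [FiniteDimensional K V] {f : V →ₗ[K] V} {C : Submodule K V} (hC : C ≤ ker f)
    (hd : Disjoint C (range f)) (hs : ∀ v ∈ ker f, ∃ r ∈ range f, ∃ c ∈ C, v = r + c) :
    finrank K C + 2 * finrank K (range f) = finrank K V + finrank K (range (f ^ 2)) := by
  have h1 : C ⊔ (ker f ⊓ range f) = ker f := by
    refine le_antisymm (sup_le hC inf_le_left) fun v hv => ?_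
    obtain ⟨r, hr, c, hc, rfl⟩ := hs v hv
    rw [add_comm]
    exact Submodule.add_mem_sup hc ⟨((ker f).add_mem_iff_left (hC hc)).1 hv, hr⟩
  have h2 : C ⊓ (ker f ⊓ range f) = ⊥ := (hd.mono_right inf_le_right).eq_bot
  have h3 := Submodule.finrank_sup_add_finrank_inf_eq C (ker f ⊓ range f)
  rw [h1, h2, finrank_bot] at h3
  have h4 := finrank_range_add_finrank_ker f
  have h5 := finrank_range_add_finrank_ker (f.domRestrict (range f))
  have h6 : finrank K (ker (f.domRestrict (range f))) =
      finrank K (ker f ⊓ range f : Submodule K V) := by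
    rw [← Submodule.finrank_map_subtype_eq, LinearMap.ker_domRestrict, Submodule.map_comap_subtype,
      inf_comm]
  have h7 : range (f.domRestrict (range f)) = range (f ^ 2) := by
    rw [LinearMap.range_domRestrict, sq, Module.End.mul_eq_comp, range_comp]
  rw [h6, h7] at h5
  omega

/-- An isomorphism between the ranges of `f` and `g` intertwining them extends
to the whole spaces as soon as the dimensions allow it. -/
theorem LinearMap.exists_linearEquiv_extending_range {V W : Type*} [AddCommGroup V] [Module K V]
    [FiniteDimensional K V] [AddCommGroup W] [Module K W] [FiniteDimensional K W]
    {f : V →ₗ[K] V} {g : W →ₗ[K] W} (φ : range f ≃ₗ[K] range g)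
    (hφ : ∀ x : range f, (φ ⟨f x, x, rfl⟩ : W) = g (φ x))
    (hVW : finrank K V = finrank K W)
    (h2 : finrank K (range (f ^ 2)) = finrank K (range (g ^ 2))) :
    ∃ e : V ≃ₗ[K] W, ∀ v, e (f v) = g (e v) := by
  obtain ⟨C, hC, hd, hs⟩ := f.exists_isCompl_range_in_ker
  obtain ⟨D, hD, hd', hs'⟩ := g.exists_isCompl_range_in_ker
  have hCD : finrank K C = finrank K D := by
    have := finrank_add_eq_of_isCompl_in_ker hC hd hs
    have := finrank_add_eq_of_isCompl_in_ker hD hd' hs'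
    have := φ.finrank_eq
    omega
  let κ : C ≃ₗ[K] D := LinearEquiv.ofFinrankEq C D hCD
  obtain ⟨L, hL⟩ := (C.subtype.coprod (range f).subtype).exists_leftInverse_of_injective (by
    rw [LinearMap.ker_coprod_of_disjoint_range _ _ (by simpa using hd)]
    simp)
  obtain ⟨s, hsec⟩ := g.rangeRestrict.exists_rightInverse_of_surjective g.range_rangeRestrict
  have hgs (y : range g) : g (s y) = y := congrArg Subtype.val (LinearMap.congr_fun hsec y)
  have hLC (c : C) : L c = (c, 0) := by simpa using LinearMap.congr_fun hL (c, 0)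
  have hLR (r : range f) : L r = (0, r) := by simpa using LinearMap.congr_fun hL (0, r)
  let p : V →ₗ[K] range f := LinearMap.snd K C (range f) ∘ₗ L
  let π : V →ₗ[K] C := LinearMap.fst K C (range f) ∘ₗ L
  let ψ : V →ₗ[K] W := (range g).subtype ∘ₗ φ.toLinearMap ∘ₗ p + D.subtype ∘ₗ κ.toLinearMap ∘ₗ π +
    s ∘ₗ φ.toLinearMap ∘ₗ f.rangeRestrict ∘ₗ (LinearMap.id - (range f).subtype ∘ₗ p)
  have hψ (v : V) : ψ v = φ (p v) + κ (π v) + s (φ (f.rangeRestrict (v - p v))) := rfl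
  have hψR (r : range f) : ψ r = φ r := by simp [hψ, p, π, hLR]
  have hψC (c : C) : ψ c = κ c := by
    have : f.rangeRestrict (c : V) = 0 := Subtype.ext (hC c.2)
    simp [hψ, p, π, hLC, this]
  have hgψ (v : V) : g (ψ v) = φ (f.rangeRestrict v) := by
    have h1 : g (κ (π v)) = 0 := hD (κ (π v)).2
    have h2 : f.rangeRestrict (p v : V) = ⟨f (p v), p v, rfl⟩ := rfl
    rw [hψ, map_add, map_add, hgs, h1, ← hφ, map_sub, map_sub, h2]
    simp
  have hinj : Function.Injective ψ := by
    rw [injective_iff_map_eq_zero]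
    intro v hv
    have h0 : f.rangeRestrict v = 0 := by
      have := hgψ v
      rw [hv, map_zero] at this
      simpa using this.symm
    obtain ⟨r, hr, c, hc, rfl⟩ := hs v (congrArg Subtype.val h0)
    rw [map_add, hψR ⟨r, hr⟩, hψC ⟨c, hc⟩] at hv
    have h3 : (κ ⟨c, hc⟩ : W) = 0 := by
      refine Submodule.disjoint_def.1 hd' _ (κ ⟨c, hc⟩).2 ?_
      rw [← neg_eq_of_add_eq_zero_right hv]
      exact neg_mem (φ ⟨r, hr⟩).2
    rw [h3, add_zero] at hv
    have h4 : r = 0 := by simpa using hv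
    have h5 : c = 0 := by simpa using h3
    rw [h4, h5, add_zero]
  refine ⟨LinearEquiv.ofInjectiveOfFinrankEq ψ hinj hVW, fun v => ?_⟩
  exact (hψR (f.rangeRestrict v)).trans (hgψ v).symm

/-- Two endomorphisms whose powers have the same ranks are similar if one of them is nilpotent. -/
theorem LinearMap.exists_linearEquiv_of_finrank_range_pow_eq {V W : Type*} [AddCommGroup V]
    [Module K V] [FiniteDimensional K V] [AddCommGroup W] [Module K W] [FiniteDimensional K W]
    {f : Module.End K V} {g : Module.End K W} (hf : IsNilpotent f)
    (h : ∀ r, finrank K (range (f ^ r)) = finrank K (range (g ^ r))) :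
    ∃ e : V ≃ₗ[K] W, ∀ v, e (f v) = g (e v) := by
  obtain ⟨k, hk⟩ := hf
  have hVW : finrank K V = finrank K W := by
    have h0 := h 0
    rwa [pow_zero, pow_zero, Module.End.one_eq_id, Module.End.one_eq_id, range_id, range_id,
      finrank_top, finrank_top] at h0
  induction k generalizing V W with
  | zero =>
    have : Subsingleton V := by
      refine ⟨fun x y => ?_⟩
      rw [← Module.End.one_apply (R := K) x, ← Module.End.one_apply (R := K) y, ← pow_zero f, hk]
      rfl
    have e := LinearEquiv.ofFinrankEq V W hVW
    have := e.symm.injective.subsingleton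
    exact ⟨e, fun v => Subsingleton.elim _ _⟩
  | succ k ih =>
    have hfr : ∀ x ∈ range f, f x ∈ range f := fun x _ => ⟨x, rfl⟩
    have hgr : ∀ x ∈ range g, g x ∈ range g := fun x _ => ⟨x, rfl⟩
    obtain ⟨φ, hφ⟩ := ih (f := f.restrict hfr) (g := g.restrict hgr)
      (fun r => by rw [finrank_range_restrict_pow, finrank_range_restrict_pow, h])
      (by
        rw [Module.End.pow_restrict]
        ext ⟨_, y, rfl⟩
        simpa [pow_succ] using LinearMap.congr_fun hk y)
      (by have h1 := h 1; rwa [pow_one, pow_one] at h1)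
    exact exists_linearEquiv_extending_range φ
      (fun x => congrArg Subtype.val (hφ x)) hVW (h 2)

end Nilpotent

/-- Square matrices over a field whose powers have the same ranks are similar if one of them is
nilpotent. -/
theorem Matrix.exists_similar_of_rank_pow_eq {K ι : Type*} [Field K] [Fintype ι] [DecidableEq ι]
    {N M : Matrix ι ι K} (hN : IsNilpotent N) (h : ∀ r, (N ^ r).rank = (M ^ r).rank) :
    ∃ P : Matrix ι ι K, IsUnit P.det ∧ P * N = M * P := by
  obtain ⟨e, he⟩ := LinearMap.exists_linearEquiv_of_finrank_range_pow_eq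
    (f := N.toLin') (g := M.toLin') (hN.map Matrix.toLinAlgEquiv') (fun r => by
      rw [← Matrix.toLin'_pow, ← Matrix.toLin'_pow]; exact h r)
  refine ⟨LinearMap.toMatrix' e.toLinearMap, ?_, ?_⟩
  · rw [LinearMap.det_toMatrix']
    exact LinearEquiv.isUnit_det' e
  · apply Matrix.toLin'.injective
    rw [Matrix.toLin'_mul, Matrix.toLin'_mul, Matrix.toLin'_toMatrix']
    exact LinearMap.ext he

/-- Two nilpotent skew-symmetric matrices `N, M ∈ so(n, ℂ)` are conjugate by an
element of `O(n, ℂ)` if and only if `rank(N^r) = rank(M^r)` for all `r ≥ 1`. -/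
theorem so_nilpotent_orbits_classified_by_jordan_type
    (n : ℕ) (N M : Matrix (Fin n) (Fin n) ℂ)
    (hNnil : IsNilpotent N) (hMnil : IsNilpotent M)
    (hNso : N.transpose = -N) (hMso : M.transpose = -M) :
    (∃ g : Matrix (Fin n) (Fin n) ℂ,
        g.transpose * g = 1 ∧ M = g * N * g⁻¹) ↔
      (∀ r : ℕ, 1 ≤ r → (N ^ r).rank = (M ^ r).rank) := by
  constructor
  · rintro ⟨g, hg, rfl⟩ r -
    have hdet : IsUnit g.det := Matrix.isUnit_det_of_left_inverse hg
    have hconj : (g * N * g⁻¹) ^ r = g * N ^ r * g⁻¹ := by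
      have : SemiconjBy g (N ^ r) ((g * N * g⁻¹) ^ r) := by
        apply SemiconjBy.pow_right
        rw [SemiconjBy, mul_assoc _ g⁻¹, Matrix.nonsing_inv_mul _ hdet, mul_one]
      rw [this.eq, mul_assoc _ g, Matrix.mul_nonsing_inv _ hdet, mul_one]
    rw [hconj, Matrix.rank_mul_eq_left_of_isUnit_det _ _ (Matrix.isUnit_nonsing_inv_det g hdet),
      Matrix.rank_mul_eq_right_of_isUnit_det _ _ hdet]
  · intro h
    obtain ⟨P, hP, hPN⟩ := Matrix.exists_similar_of_rank_pow_eq hNnil (M := M) fun r => by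
      rcases r.eq_zero_or_pos with rfl | hr
      · simp
      · exact h r hr
    exact Matrix.exists_orthogonal_conj_of_similar hNso hMso hP hPN
end

section
/- Let c = (c_{2k}, …, c_0) be an Sp-column sequence with k ≥ 1 and total sum 2m, let w(c) be the nondecreasing tuple produced by the pair-removal algorithm, and let B(w(c)) be the output of the multiplicity algorithm applied to w(c). Then B(w(c))_0 = 1 and B(w(c))_j ≥ 0 for every j with 2j ≤ m. (By Theorem 2.3, B(w(c))_j equals the multiplicity of the fundamental representation μ_{2j} of Sp(2m,ℂ) in the ring of regular functions on the corresponding nilpotent orbit.) -/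
/-- An Sp-column sequence `(c_{2k}, …, c_0)`, recorded from the bottom: `c j` is the entry
`c_j`, so `c 0 ≤ c 1 ≤ … ≤ c (2k)`, `c 0` is even, and `c (2i) + c (2i−1)` is even for
`1 ≤ i ≤ k`. -/
def IsSpColumnSeq (k : ℕ) (c : ℕ → ℕ) : Prop :=
  (∀ i : ℕ, i < 2 * k → c i ≤ c (i + 1)) ∧ Even (c 0) ∧
    ∀ i : ℕ, 1 ≤ i → i ≤ k → Even (c (2 * i) + c (2 * i - 1))

/-- Pair removal on a tuple listed from the bottom (`[c_0, c_1, …]`): repeatedly delete the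
adjacent equal pair with smallest index, recording the common value.  The first component is
the remaining tuple `(d_0, d_1, …)`, the second the recorded values `Y`. -/
def pairRemove : List ℕ → List ℕ × List ℕ
  | [] => ([], [])
  | [a] => ([a], [])
  | a :: b :: rest =>
      if a = b then
        ((pairRemove rest).1, a :: (pairRemove rest).2)
      else
        (a :: (pairRemove (b :: rest)).1, (pairRemove (b :: rest)).2)

/-- Helper for `zList`: turns `[d_1, d_2, d_3, d_4, …]` into `[(d_1+d_2)/2, (d_3+d_4)/2, …]`. -/
def zPairs : List ℕ → List ℕ
  | [] => []
  | [a] => [a / 2]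
  | a :: b :: rest => (a + b) / 2 :: zPairs rest

/-- The list `Z = [z_0, z_1, …]` with `z_j = (d_{2j} + d_{2j−1})/2` (and `d_{−1} := 0`),
computed from the remaining tuple `[d_0, d_1, …, d_{2l}]` listed from the bottom. -/
def zList : List ℕ → List ℕ
  | [] => []
  | a :: rest => a / 2 :: zPairs rest

/-- `w(c)`: the multiset `Y ∪ Z` produced by the pair-removal algorithm, sorted
nondecreasingly. -/
def wTuple (c : List ℕ) : List ℕ :=
  ((pairRemove c).2 ++ zList (pairRemove c).1).mergeSort (· ≤ ·)

/-- The multiplicity algorithm: `multAlg k w i j` is `β_{ij}`, where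
`β_{0j} = C(k−1+j, j)` and `β_{(i+1)j} = β_{ij} − β_{i(j−wᵢ−1)}` (terms with a negative
index being `0`).  The output of the algorithm is `B(w) = β_{k+1}`. -/
def multAlg (k : ℕ) (w : ℕ → ℕ) : ℕ → ℕ → ℤ
  | 0, j => (Nat.choose (k - 1 + j) j : ℤ)
  | i + 1, j =>
      multAlg k w i j - if w i + 1 ≤ j then multAlg k w i (j - (w i + 1)) else 0

/-- The list splits into consecutive pairs each having an even sum. -/
def EvenPairs : List ℕ → Prop
  | [] => True
  | [_] => False
  | a :: b :: rest => Even (a + b) ∧ EvenPairs rest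

theorem EvenPairs.cons_of_even_add {a x : ℕ} (hxa : Even (x + a)) :
    ∀ {l : List ℕ}, EvenPairs (a :: l) → EvenPairs (x :: l)
  | [], h => h.elim
  | b :: l, h => by
    refine ⟨?_, h.2⟩
    have := h.1
    grind

theorem EvenPairs.pairRemove_fst (l : List ℕ) :
    (EvenPairs l → EvenPairs (pairRemove l).1) ∧
      ∀ x, EvenPairs (x :: l) → EvenPairs (x :: (pairRemove l).1) := by
  fun_induction pairRemove l with
  | case1 => exact ⟨id, fun _ => id⟩
  | case2 a => exact ⟨id, fun _ => id⟩
  | case3 a rest ih => exact ⟨fun h => ih.1 h.2, fun x h => (ih.2 a h.2).cons_of_even_add h.1⟩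
  | case4 a b rest hab ih => exact ⟨fun h => ih.2 a h, fun x h => ⟨h.1, ih.1 h.2⟩⟩

theorem EvenPairs.two_mul_sum_zPairs {l : List ℕ} (h : EvenPairs l) :
    2 * (zPairs l).sum = l.sum := by
  fun_induction zPairs l with
  | case1 => rfl
  | case2 a => exact h.elim
  | case3 a b rest ih =>
    have h₁ := ih h.2
    have h₂ := Nat.two_mul_div_two_of_even h.1
    simp only [List.sum_cons]
    lia

theorem EvenPairs.two_mul_length_zPairs {l : List ℕ} (h : EvenPairs l) :
    2 * (zPairs l).length = l.length := by
  fun_induction zPairs l with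
  | case1 => rfl
  | case2 a => exact h.elim
  | case3 a b rest ih =>
    have := ih h.2
    simp only [List.length_cons]
    lia

theorem sum_pairRemove (l : List ℕ) :
    2 * (pairRemove l).2.sum + (pairRemove l).1.sum = l.sum := by
  fun_induction pairRemove l <;> simp_all <;> lia

theorem length_pairRemove (l : List ℕ) :
    2 * (pairRemove l).2.length + (pairRemove l).1.length = l.length := by
  fun_induction pairRemove l <;> simp_all <;> lia

theorem EvenPairs.zList_eq {l : List ℕ} (h : EvenPairs (0 :: l)) : zList l = zPairs (0 :: l) := by
  cases l with
  | nil => exact h.elim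
  | cons a l => simp [zList, zPairs]

theorem two_mul_sum_wTuple {c : List ℕ} (h : EvenPairs (0 :: c)) :
    2 * (wTuple c).sum = c.sum := by
  have hd := (EvenPairs.pairRemove_fst c).2 0 h
  have hz := hd.two_mul_sum_zPairs
  have hs := sum_pairRemove c
  rw [wTuple, (List.mergeSort_perm _ _).sum_eq, List.sum_append, hd.zList_eq]
  simp only [List.sum_cons] at hz
  lia

theorem two_mul_length_wTuple {c : List ℕ} (h : EvenPairs (0 :: c)) :
    2 * (wTuple c).length = c.length + 1 := by
  have hd := (EvenPairs.pairRemove_fst c).2 0 h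
  have hz := hd.two_mul_length_zPairs
  have hs := length_pairRemove c
  rw [wTuple, (List.mergeSort_perm _ _).length_eq, List.length_append, hd.zList_eq]
  simp only [List.length_cons] at hz
  lia

theorem evenPairs_map_range (n : ℕ) (f : ℕ → ℕ) (h : ∀ i < n, Even (f (2 * i) + f (2 * i + 1))) :
    EvenPairs ((List.range (2 * n)).map f) := by
  induction n generalizing f with
  | zero => trivial
  | succ n ih =>
    have hr : (List.range (2 * (n + 1))).map f =
        f 0 :: f 1 :: (List.range (2 * n)).map (fun i => f (i + 2)) := by
      rw [show 2 * (n + 1) = 2 * n + 1 + 1 by ring, List.range_succ_eq_map, List.range_succ_eq_map]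
      simp [Function.comp_def]
    rw [hr]
    exact ⟨h 0 n.succ_pos, ih _ fun i hi => h (i + 1) (by lia)⟩

theorem IsSpColumnSeq.evenPairs {k : ℕ} {c : ℕ → ℕ} (hc : IsSpColumnSeq k c) :
    EvenPairs (0 :: (List.range (2 * k + 1)).map c) := by
  have h := evenPairs_map_range (k + 1) (fun i => if i = 0 then 0 else c (i - 1)) fun i hi => by
    rcases Nat.eq_zero_or_pos i with rfl | hi0
    · simpa using hc.2.1
    · have := hc.2.2 i hi0 (by lia)
      simp only [show 2 * i ≠ 0 by lia, if_false, Nat.add_one_ne_zero, Nat.add_sub_cancel]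
      rwa [add_comm]
  rw [show 2 * (k + 1) = 2 * k + 1 + 1 by ring, List.range_succ_eq_map] at h
  simpa [Function.comp_def] using h

/-- The `j`-th coefficient of `∏_{t < i} (1 + q + ⋯ + q ^ w t)`. -/
def qIntProd (w : ℕ → ℕ) : ℕ → ℤ → ℤ
  | 0, j => if j = 0 then 1 else 0
  | i + 1, j => ∑ s ∈ Finset.range (w i + 1), qIntProd w i (j - s)

theorem qIntProd_of_neg (w : ℕ → ℕ) (i : ℕ) {j : ℤ} (hj : j < 0) : qIntProd w i j = 0 := by
  induction i generalizing j with
  | zero => exact if_neg hj.ne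
  | succ i ih => exact Finset.sum_eq_zero fun s _ => ih (by lia)

theorem qIntProd_zero_right (w : ℕ → ℕ) (i : ℕ) : qIntProd w i 0 = 1 := by
  induction i with
  | zero => rfl
  | succ i ih =>
    rw [qIntProd, Finset.sum_range_succ', Finset.sum_eq_zero fun s _ =>
      qIntProd_of_neg w i (by push_cast; lia)]
    simpa using ih

theorem qIntProd_succ_sub (w : ℕ → ℕ) (i : ℕ) (j : ℤ) :
    qIntProd w (i + 1) j - qIntProd w (i + 1) (j - 1) =
      qIntProd w i j - qIntProd w i (j - (w i + 1)) := by
  have h := Finset.sum_range_sub' (fun s : ℕ => qIntProd w i (j - s)) (w i + 1)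
  rw [Finset.sum_sub_distrib] at h
  simp only [Nat.cast_add, Nat.cast_one, Nat.cast_zero, sub_zero] at h
  simp only [qIntProd]
  rw [← h]
  congr 1
  exact Finset.sum_congr rfl fun s _ => congrArg _ (by ring)

theorem qIntProd_symm (w : ℕ → ℕ) (i : ℕ) (j : ℤ) :
    qIntProd w i (∑ t ∈ Finset.range i, w t - j) = qIntProd w i j := by
  induction i generalizing j with
  | zero => simp [qIntProd]
  | succ i ih =>
    simp only [qIntProd]
    rw [← Finset.sum_range_reflect]
    refine Finset.sum_congr rfl fun s hs => ?_
    rw [← ih]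
    rw [Finset.mem_range] at hs
    congr 1
    rw [Finset.sum_range_succ]
    push_cast [show w i + 1 - 1 - s = w i - s by lia, Nat.cast_sub (show s ≤ w i by lia)]
    ring

theorem qIntProd_le_of_two_mul_le (w : ℕ → ℕ) (i : ℕ) {x y : ℤ} (hxy : x ≤ y)
    (hy : 2 * y ≤ ∑ t ∈ Finset.range i, (w t : ℤ)) : qIntProd w i x ≤ qIntProd w i y := by
  induction i generalizing x y with
  | zero =>
    rcases hxy.eq_or_lt with rfl | hlt
    · rfl
    · rw [qIntProd_of_neg w 0 (by simp at hy; lia)]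
      simp only [qIntProd]
      split <;> simp
  | succ i ih =>
    induction y, hxy using Int.leInduction with
    | base => rfl
    | succ y hxy ihy =>
      refine (ihy (by lia)).trans ?_
      have h := qIntProd_succ_sub w i (y + 1)
      rw [add_sub_cancel_right] at h
      rw [← sub_nonneg, h, sub_nonneg]
      rw [Finset.sum_range_succ] at hy
      rcases le_total (2 * (y + 1)) (∑ t ∈ Finset.range i, (w t : ℤ)) with hle | hle
      · exact ih (by lia) hle
      · rw [← qIntProd_symm w i (y + 1)]
        push_cast
        exact ih (by lia) (by lia)

open PowerSeries in
theorem mk_multAlg_succ (k : ℕ) (w : ℕ → ℕ) (i : ℕ) :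
    mk (multAlg k w (i + 1)) = mk (multAlg k w i) * (1 - X ^ (w i + 1)) := by
  ext j
  rw [mul_sub, mul_one, map_sub, coeff_mul_X_pow']
  simp [multAlg]

open PowerSeries in
theorem mk_qIntProd_succ (w : ℕ → ℕ) (i : ℕ) :
    mk (fun j => qIntProd w (i + 1) j) * (1 - X) =
      mk (fun j => qIntProd w i j) * (1 - X ^ (w i + 1)) := by
  have hshift (l n j : ℕ) : coeff j (mk (fun j => qIntProd w l j) * X ^ n) =
      qIntProd w l (j - n) := by
    rw [coeff_mul_X_pow']
    split_ifs with h
    · rw [coeff_mk, Nat.cast_sub h]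
    · exact (qIntProd_of_neg w l (by lia)).symm
  ext j
  have h := qIntProd_succ_sub w i j
  have h₁ := hshift (i + 1) 1 j
  rw [pow_one] at h₁
  rw [mul_sub, mul_one, map_sub, h₁, mul_sub, mul_one, map_sub, hshift]
  simpa using h

open PowerSeries in
theorem mk_multAlg_mul_one_sub_pow {k : ℕ} (hk : 1 ≤ k) (w : ℕ → ℕ) (i : ℕ) :
    mk (multAlg k w i) * (1 - X) ^ k = mk (fun j => qIntProd w i j) * (1 - X) ^ i := by
  induction i with
  | zero =>
    obtain ⟨d, rfl⟩ : ∃ d, k = d + 1 := ⟨k - 1, by lia⟩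
    have h₀ : mk (multAlg (d + 1) w 0) = (mk 1 : PowerSeries ℤ) ^ (d + 1) := by
      rw [mk_one_pow_eq_mk_choose_add]
      ext j
      simpa [multAlg] using Nat.choose_symm_add.symm
    have h₁ : mk (fun j : ℕ => qIntProd w 0 j) = 1 := by
      ext j
      simp [qIntProd, coeff_one]
    rw [h₀, h₁, ← mul_pow, mk_one_mul_one_sub_eq_one]
    simp
  | succ i ih =>
    rw [mk_multAlg_succ, mul_right_comm, ih, pow_succ' (1 - X) i, ← mul_assoc, mk_qIntProd_succ]
    ring

open PowerSeries in
theorem multAlg_eq_qIntProd_sub {k : ℕ} (hk : 1 ≤ k) (w : ℕ → ℕ) (j : ℕ) :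
    multAlg k w (k + 1) j = qIntProd w (k + 1) j - qIntProd w (k + 1) (j - 1) := by
  have hne : (1 - X : PowerSeries ℤ) ≠ 0 := by
    intro h
    simpa using congrArg (coeff 0) h
  have h := mk_multAlg_mul_one_sub_pow hk w (k + 1)
  rw [pow_succ', ← mul_assoc] at h
  have hj := congrArg (coeff j) (mul_right_cancel₀ (pow_ne_zero k hne) h)
  rw [mk_qIntProd_succ, mul_sub, mul_one, map_sub, coeff_mul_X_pow', coeff_mk, coeff_mk] at hj
  rw [hj, qIntProd_succ_sub]
  split_ifs with hle
  · rw [coeff_mk, Nat.cast_sub hle]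
    push_cast
    rfl
  · rw [qIntProd_of_neg w k (by lia : (j : ℤ) - (w k + 1) < 0)]

theorem sum_range_getD (l : List ℕ) : ∑ t ∈ Finset.range l.length, l.getD t 0 = l.sum := by
  rw [Finset.sum_range, ← List.sum_ofFn]
  simp

/-- for an Sp-column sequence `c` with `k ≥ 1` and total sum `2m`, the output
`B(w(c))` of the multiplicity algorithm applied to `w(c)` has `B(w(c))_0 = 1` and
`B(w(c))_j ≥ 0` whenever `2j ≤ m`; by Theorem 2.3 these are the multiplicities of the even
fundamental representations of `Sp(2m, ℂ)` in the ring of regular functions on the orbit. -/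
theorem multAlg_of_wTuple_nonneg (k m : ℕ) (hk : 1 ≤ k) (c : ℕ → ℕ)
    (hc : IsSpColumnSeq k c)
    (hm : ∑ j ∈ Finset.range (2 * k + 1), c j = 2 * m) :
    multAlg k (fun i => (wTuple ((List.range (2 * k + 1)).map c)).getD i 0) (k + 1) 0 = 1 ∧
    ∀ j : ℕ, 2 * j ≤ m →
      0 ≤ multAlg k (fun i => (wTuple ((List.range (2 * k + 1)).map c)).getD i 0) (k + 1) j := by
  have hE := hc.evenPairs
  have hlen := two_mul_length_wTuple hE
  have hsum := two_mul_sum_wTuple hE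
  set l := wTuple ((List.range (2 * k + 1)).map c)
  have hc_sum : ((List.range (2 * k + 1)).map c).sum = 2 * m := hm
  have hl : l.length = k + 1 := by
    simp only [List.length_map, List.length_range] at hlen
    lia
  have hdeg : ∑ t ∈ Finset.range (k + 1), l.getD t 0 = m := by
    rw [← hl, sum_range_getD]
    lia
  refine ⟨?_, fun j hj => ?_⟩
  · rw [multAlg_eq_qIntProd_sub hk, qIntProd_of_neg _ _ (j := ((0 : ℕ) : ℤ) - 1) (by simp),
      Nat.cast_zero, qIntProd_zero_right, sub_zero]
  · rw [multAlg_eq_qIntProd_sub hk, sub_nonneg]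
    refine qIntProd_le_of_two_mul_le _ _ (by lia) ?_
    rw [← Nat.cast_sum, hdeg]
    exact_mod_cast hj
end
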